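/- arXiv:1206.0119 — 4 statements merged into one kernel-verified Lean document; each statement's English description precedes it below -/
import Mathlib

section
/- Let F : ℝ → ℝ be continuous, let a ∈ ℝ, and fix ε > 0. Then (1/2)·∫_{a-ε}^{a+ε} F(μ)·α/(α² + (μ - a)²) dμ tends to (π/2)·F(a) as α tends to 0 from the right. (This is Cauchy's 1827 singular-integral formula (2).) -/
open Real MeasureTheory Filter Topology

/-- Cauchy's 1827 singular-integral formula (2): for continuous `F` and fixed `ε > 0`,
`(1/2) ∫_{a-ε}^{a+ε} F(μ) α/(α² + (μ-a)²) dμ → (π/2) F(a)` as `α → 0⁺`. -/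
theorem cauchy_singular_integral_formula (F : ℝ → ℝ) (hF : Continuous F) (a ε : ℝ)
    (hε : 0 < ε) :
    Tendsto (fun α : ℝ => (1 / 2) * ∫ μ in (a - ε)..(a + ε),
        F μ * (α / (α ^ 2 + (μ - a) ^ 2)))
      (𝓝[>] 0) (𝓝 ((π / 2) * F a)) := by
  obtain ⟨C, hC⟩ := (isCompact_Icc (a := a - ε) (b := a + ε)).exists_bound_of_continuousOn
    hF.continuousOn
  have hC0 : 0 ≤ C := (norm_nonneg _).trans (hC a ⟨by linarith, by linarith⟩)
  let G : ℝ → ℝ → ℝ := fun α =>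
    (Set.Ioc (-(ε / α)) (ε / α)).indicator (fun t => F (α * t + a) * (1 + t ^ 2)⁻¹)
  have hpos : ∀ᶠ α : ℝ in 𝓝[>] 0, 0 < α := self_mem_nhdsWithin
  have hsub : ∀ᶠ α : ℝ in 𝓝[>] 0, (1 / 2) * ∫ t, G α t =
      (1 / 2) * ∫ μ in (a - ε)..(a + ε), F μ * (α / (α ^ 2 + (μ - a) ^ 2)) := by
    filter_upwards [hpos] with α hα
    have h1 : ∫ t, G α t = ∫ t in (-(ε / α))..(ε / α), F (α * t + a) * (1 + t ^ 2)⁻¹ := by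
      have : 0 < ε / α := by positivity
      rw [intervalIntegral.integral_of_le (by linarith), integral_indicator measurableSet_Ioc]
    have h2 := intervalIntegral.smul_integral_comp_mul_add (a := -(ε / α)) (b := ε / α)
      (fun μ => F μ * (α / (α ^ 2 + (μ - a) ^ 2))) α a
    have e1 : α * -(ε / α) + a = a - ε := by field_simp; ring
    have e2 : α * (ε / α) + a = a + ε := by field_simp; ring
    rw [e1, e2] at h2
    refine congrArg (fun z => (1 / 2 : ℝ) * z) ?_
    rw [h1, ← h2, smul_eq_mul, ← intervalIntegral.integral_const_mul]
    refine intervalIntegral.integral_congr fun t _ => ?_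
    beta_reduce
    have : 1 + t ^ 2 ≠ 0 := by positivity
    have h3 : α ^ 2 + (α * t + a - a) ^ 2 = α ^ 2 * (1 + t ^ 2) := by ring
    rw [h3]
    field_simp
  refine Tendsto.congr' hsub ?_
  have hlim : Tendsto (fun α => ∫ t, G α t) (𝓝[>] 0) (𝓝 (∫ t, F a * (1 + t ^ 2)⁻¹)) := by
    refine tendsto_integral_filter_of_dominated_convergence (fun t => C * (1 + t ^ 2)⁻¹)
      ?_ ?_ (integrable_inv_one_add_sq.const_mul C) ?_
    · refine Eventually.of_forall fun α => ?_
      refine (Measurable.indicator ?_ measurableSet_Ioc).aestronglyMeasurable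
      have := hF.measurable
      fun_prop
    · filter_upwards [hpos] with α hα
      refine Eventually.of_forall fun t => ?_
      have hp : 0 ≤ (1 + t ^ 2)⁻¹ := by positivity
      by_cases ht : t ∈ Set.Ioc (-(ε / α)) (ε / α)
      · simp only [G, Set.indicator_of_mem ht, norm_mul, Real.norm_of_nonneg hp]
        refine mul_le_mul_of_nonneg_right (hC _ ?_) hp
        have e2 : α * (ε / α) = ε := by field_simp
        have h1 := mul_le_mul_of_nonneg_left ht.1.le hα.le
        have h2 := mul_le_mul_of_nonneg_left ht.2 hα.le
        constructor <;> linarith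
      · simp only [G, Set.indicator_of_notMem ht, norm_zero]
        positivity
    · refine Eventually.of_forall fun t => ?_
      have hc : Tendsto (fun α : ℝ => F (α * t + a) * (1 + t ^ 2)⁻¹) (𝓝[>] 0)
          (𝓝 (F a * (1 + t ^ 2)⁻¹)) := by
        have : Continuous (fun α : ℝ => F (α * t + a) * (1 + t ^ 2)⁻¹) := by fun_prop
        have := this.tendsto 0
        simp only [zero_mul, zero_add] at this
        exact this.mono_left nhdsWithin_le_nhds
      refine hc.congr' ?_
      have hs : ∀ᶠ α : ℝ in 𝓝[>] 0, |t| * α < ε := by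
        have : Continuous (fun α : ℝ => |t| * α) := by fun_prop
        have := this.tendsto 0
        simp only [mul_zero] at this
        exact (this.mono_left nhdsWithin_le_nhds).eventually (gt_mem_nhds hε)
      filter_upwards [hpos, hs] with α hα h
      have h' := abs_lt.1 ((lt_div_iff₀ hα).2 h)
      exact (Set.indicator_of_mem (s := Set.Ioc (-(ε / α)) (ε / α)) ⟨h'.1, h'.2.le⟩
        (fun t => F (α * t + a) * (1 + t ^ 2)⁻¹)).symm
  rw [integral_const_mul, integral_univ_inv_one_add_sq] at hlim
  have := hlim.const_mul (1 / 2)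
  convert this using 2
  ring
end

section
/- Let F : ℝ → ℝ be continuous and let a ∈ ℝ. Then (1/2)·∫_{a-√α}^{a+√α} F(μ)·α/(α² + (μ - a)²) dμ tends to (π/2)·F(a) as α tends to 0 from the right. (Laugwitz's observation that Cauchy's formula (2) already holds when the width of the window of integration is ε = α^{1/2}.) -/
open Real MeasureTheory Filter Topology

lemma csi_kernel_cont (a α : ℝ) (hα : 0 < α) :
    Continuous (fun μ : ℝ => α / (α ^ 2 + (μ - a) ^ 2)) := by
  refine Continuous.div (by fun_prop) (by fun_prop) ?_
  intro x
  positivity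

lemma csi_kernel_integral (a α : ℝ) (hα : 0 < α) :
    ∫ μ in (a - Real.sqrt α)..(a + Real.sqrt α), α / (α ^ 2 + (μ - a) ^ 2)
      = 2 * arctan (Real.sqrt α / α) := by
  have h := intervalIntegral.integral_eq_sub_of_hasDerivAt
    (a := a - Real.sqrt α) (b := a + Real.sqrt α)
    (f := fun μ : ℝ => arctan ((μ - a) / α))
    (f' := fun μ : ℝ => α / (α ^ 2 + (μ - a) ^ 2))
    (fun x _ => by
      have h1 : HasDerivAt (fun μ : ℝ => (μ - a) / α) (1 / α) x :=
        ((hasDerivAt_id x).sub_const a).div_const α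
      have h3 : 1 + ((x - a) / α) ^ 2 ≠ 0 := by positivity
      have h4 : α ^ 2 + (x - a) ^ 2 ≠ 0 := by positivity
      have h5 : 1 / (1 + ((x - a) / α) ^ 2) * (1 / α) = α / (α ^ 2 + (x - a) ^ 2) := by
        field_simp
      have h2 := h1.arctan
      rw [h5] at h2
      exact h2)
    ((csi_kernel_cont a α hα).intervalIntegrable _ _)
  rw [h]
  have e1 : (a + Real.sqrt α - a) / α = Real.sqrt α / α := by ring
  have e2 : (a - Real.sqrt α - a) / α = -(Real.sqrt α / α) := by ring
  simp only [e1, e2, arctan_neg]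
  ring

/-- Laugwitz's observation: Cauchy's formula (2) already holds when the width of the
window of integration is `ε = √α`. -/
theorem cauchy_singular_integral_sqrt_window (F : ℝ → ℝ) (hF : Continuous F) (a : ℝ) :
    Tendsto (fun α : ℝ => (1 / 2) * ∫ μ in (a - Real.sqrt α)..(a + Real.sqrt α),
        F μ * (α / (α ^ 2 + (μ - a) ^ 2)))
      (𝓝[>] 0) (𝓝 ((π / 2) * F a)) := by
  have hK : Tendsto (fun α : ℝ => arctan (Real.sqrt α / α)) (𝓝[>] 0) (𝓝 (π / 2)) := by
    refine (tendsto_arctan_atTop.mono_right nhdsWithin_le_nhds).comp ?_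
    have h0 : Tendsto Real.sqrt (𝓝[>] 0) (𝓝[>] 0) := by
      refine tendsto_nhdsWithin_iff.2 ⟨?_, ?_⟩
      · have := (Real.continuous_sqrt.tendsto 0).mono_left (nhdsWithin_le_nhds (s := Set.Ioi 0))
        simpa using this
      · filter_upwards [self_mem_nhdsWithin] with x hx
        exact Real.sqrt_pos.2 hx
    refine (tendsto_inv_nhdsGT_zero.comp h0).congr ?_
    intro x
    simp [Real.sqrt_div_self]
  have hD : Tendsto (fun α : ℝ => ∫ μ in (a - Real.sqrt α)..(a + Real.sqrt α),
      (F μ - F a) * (α / (α ^ 2 + (μ - a) ^ 2))) (𝓝[>] 0) (𝓝 0) := by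
    rw [Metric.tendsto_nhds]
    intro ε hε
    obtain ⟨δ, hδ, hFδ⟩ := Metric.continuousAt_iff.1 hF.continuousAt (ε / 4) (by positivity)
    have hlt : ∀ᶠ α : ℝ in 𝓝[>] 0, α < δ ^ 2 :=
      nhdsWithin_le_nhds (Iio_mem_nhds (by positivity))
    filter_upwards [self_mem_nhdsWithin, hlt] with α hα hαδ
    have hα : 0 < α := hα
    have hs : Real.sqrt α < δ := (Real.sqrt_lt' hδ).2 hαδ
    have hs0 := Real.sqrt_nonneg α
    have hb := intervalIntegral.norm_integral_le_of_norm_le (μ := volume)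
      (a := a - Real.sqrt α) (b := a + Real.sqrt α)
      (f := fun μ => (F μ - F a) * (α / (α ^ 2 + (μ - a) ^ 2)))
      (g := fun μ => ε / 4 * (α / (α ^ 2 + (μ - a) ^ 2)))
      (by linarith)
      (Eventually.of_forall fun x hx => by
        rw [norm_mul, Real.norm_of_nonneg (r := α / (α ^ 2 + (x - a) ^ 2)) (by positivity)]
        refine mul_le_mul_of_nonneg_right ?_ (by positivity)
        have : dist x a < δ := by
          rw [Real.dist_eq, abs_lt]
          constructor <;> linarith [hx.1, hx.2]
        exact (hFδ this).le)
      (((csi_kernel_cont a α hα).const_mul _).intervalIntegrable _ _)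
    rw [intervalIntegral.integral_const_mul, csi_kernel_integral a α hα] at hb
    rw [dist_zero_right]
    have h1 := arctan_lt_pi_div_two (Real.sqrt α / α)
    have h2 := Real.pi_lt_four
    have : ε / 4 * (2 * arctan (Real.sqrt α / α)) < ε / 4 * 4 :=
      mul_lt_mul_of_pos_left (by linarith) (by positivity)
    linarith
  have hsum := (hD.const_mul (1 / 2)).add (hK.mul_const (F a))
  rw [mul_zero, zero_add] at hsum
  refine hsum.congr' ?_
  filter_upwards [self_mem_nhdsWithin] with α hα
  have hα : 0 < α := hα
  have hk := csi_kernel_cont a α hα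
  have hFk : Continuous (fun μ : ℝ => F μ * (α / (α ^ 2 + (μ - a) ^ 2))) := hF.mul hk
  simp only [sub_mul]
  rw [intervalIntegral.integral_sub (hFk.intervalIntegrable _ _)
    ((hk.const_mul _).intervalIntegrable _ _),
    intervalIntegral.integral_const_mul, csi_kernel_integral a α hα]
  ring
end

section
/- For every continuously differentiable function f : ℝ → ℝ with compact support, ∫_ℝ arctan(x/α)·f′(x) dx tends to −π·f(0) as α tends to 0 from the right. (Differentiating the infinitesimal-scale approximation arctan(x/α) of the zigzag recovers π times the Dirac delta in the weak sense.) -/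
open Real MeasureTheory Filter Topology

/-- Differentiating the infinitesimal-scale approximation `arctan (x/α)` of the zigzag
recovers `π` times the Dirac delta in the weak sense: for every continuously
differentiable `f : ℝ → ℝ` with compact support,
`∫_ℝ arctan (x/α) f'(x) dx → -π f(0)` as `α → 0⁺`. -/
theorem arctan_zigzag_weak_derivative (f : ℝ → ℝ) (hf : ContDiff ℝ 1 f)
    (hsupp : HasCompactSupport f) :
    Tendsto (fun α : ℝ => ∫ x : ℝ, Real.arctan (x / α) * deriv f x)
      (𝓝[>] 0) (𝓝 (-(π * f 0))) := by
  have hcd : Continuous (deriv f) := hf.continuous_deriv le_rfl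
  have hint : Integrable (deriv f) := hcd.integrable_of_hasCompactSupport hsupp.deriv
  set s : ℝ → ℝ := fun x => if x ≤ 0 then -(π / 2) else π / 2 with hs
  have hval : ∫ x, s x * deriv f x = -(π * f 0) := by
    have e1 : Set.EqOn (fun x => s x * deriv f x) (fun x => -(π / 2) * deriv f x)
        (Set.Iic 0) := by
      intro x hx
      simp only [hs, if_pos (Set.mem_Iic.1 hx)]
    have e2 : Set.EqOn (fun x => s x * deriv f x) (fun x => (π / 2) * deriv f x)
        (Set.Ioi 0) := by
      intro x hx
      simp only [hs, if_neg (not_le.2 (Set.mem_Ioi.1 hx))]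
    have i1 : IntegrableOn (fun x => s x * deriv f x) (Set.Iic 0) :=
      (integrableOn_congr_fun e1 measurableSet_Iic).2 (hint.const_mul _).integrableOn
    have i2 : IntegrableOn (fun x => s x * deriv f x) (Set.Ioi 0) :=
      (integrableOn_congr_fun e2 measurableSet_Ioi).2 (hint.const_mul _).integrableOn
    rw [← intervalIntegral.integral_Iic_add_Ioi i1 i2,
      setIntegral_congr_fun measurableSet_Iic e1, setIntegral_congr_fun measurableSet_Ioi e2,
      integral_const_mul, integral_const_mul, hsupp.integral_Iic_deriv_eq hf,
      hsupp.integral_Ioi_deriv_eq hf]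
    ring
  rw [← hval]
  refine tendsto_integral_filter_of_dominated_convergence (fun x => π / 2 * ‖deriv f x‖)
    ?_ ?_ (hint.norm.const_mul _) ?_
  · refine Eventually.of_forall fun α => Continuous.aestronglyMeasurable ?_
    exact (Real.continuous_arctan.comp (continuous_id.div_const α)).mul hcd
  · refine Eventually.of_forall fun α => Eventually.of_forall fun x => ?_
    rw [norm_mul]
    refine mul_le_mul_of_nonneg_right ?_ (norm_nonneg _)
    rw [Real.norm_eq_abs, abs_le]
    exact ⟨(Real.neg_pi_div_two_lt_arctan _).le, (Real.arctan_lt_pi_div_two _).le⟩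
  · filter_upwards [Measure.ae_ne volume (0 : ℝ)] with x hx
    refine Tendsto.mul_const _ ?_
    rcases lt_or_gt_of_ne hx with h | h
    · simp only [hs, if_pos h.le, div_eq_mul_inv x]
      exact (Real.tendsto_arctan_atBot.mono_right nhdsWithin_le_nhds).comp
        (tendsto_inv_nhdsGT_zero.const_mul_atTop_of_neg h)
    · simp only [hs, if_neg (not_le.2 h), div_eq_mul_inv x]
      exact (Real.tendsto_arctan_atTop.mono_right nhdsWithin_le_nhds).comp
        (tendsto_inv_nhdsGT_zero.const_mul_atTop h)
end

section
/- Let f : ℝ → ℝ be continuous and periodic with period 2π, and let x ∈ ℝ. Then ∫_0^{2π} f(μ)·K_θ(x − μ) dμ tends to 2π·f(x) as θ tends to 1 from the left, where K_θ(t) = ((1 − θ)² + 2(1 − θ)·cos t)/(1 − 2θ·cos t + θ²). (This makes precise Cauchy's 1827 claim that his Fourier kernel, with θ = 1 − ε for ε infinitesimal, reduces the integral to 2π·f(x).) -/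
open Real MeasureTheory Filter Topology

lemma cp_den_pos (θ t : ℝ) (h0 : 0 < θ) (h1 : θ < 1) : 0 < 1 - 2 * θ * Real.cos t + θ ^ 2 := by
  nlinarith [Real.cos_le_one t, mul_nonneg h0.le (sub_nonneg.2 (Real.cos_le_one t)),
    pow_pos (sub_pos.2 h1) 2]

lemma cp_cont (θ : ℝ) (h0 : 0 < θ) (h1 : θ < 1) :
    Continuous (fun t : ℝ => (1 - θ ^ 2) / (1 - 2 * θ * Real.cos t + θ ^ 2)) := by
  refine Continuous.div (by fun_prop) (by fun_prop) (fun t => (cp_den_pos θ t h0 h1).ne')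

lemma cp_mass (θ : ℝ) (h0 : 0 < θ) (h1 : θ < 1) :
    ∫ t in (0:ℝ)..(2 * π), (1 - θ ^ 2) / (1 - 2 * θ * Real.cos t + θ ^ 2) = 2 * π := by
  have h := DiffContOnCl.circleAverage_poissonKernel_smul (c := 0) (R := 1) (w := (θ : ℂ))
    (f := fun _ : ℂ => (1 : ℂ)) diffContOnCl_const (by simp [abs_of_pos h0, h1])
  rw [circleAverage_def] at h
  have e : ∀ t : ℝ, poissonKernel 0 (θ : ℂ) (circleMap 0 1 t)
      = (1 - θ ^ 2) / (1 - 2 * θ * Real.cos t + θ ^ 2) := by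
    intro t
    rw [poissonKernel_def, sub_zero, sub_zero]
    have e1 : ‖circleMap 0 1 t‖ = 1 := by simp
    have e2 : ‖(θ : ℂ)‖ ^ 2 = θ ^ 2 := by simp
    have e3 : ‖circleMap 0 1 t - (θ : ℂ)‖ ^ 2 = 1 - 2 * θ * Real.cos t + θ ^ 2 := by
      rw [← Complex.normSq_eq_norm_sq, Complex.normSq_apply]
      simp [circleMap, Complex.exp_ofReal_mul_I_re, Complex.exp_ofReal_mul_I_im]
      nlinarith [Real.sin_sq_add_cos_sq t]
    rw [e1, e2, e3, one_pow]
  have e' : ∀ t : ℝ, (poissonKernel 0 (θ : ℂ) • fun _ : ℂ => (1 : ℂ)) (circleMap 0 1 t)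
      = (((1 - θ ^ 2) / (1 - 2 * θ * Real.cos t + θ ^ 2) : ℝ) : ℂ) := by
    intro t
    rw [← e t]
    simp [Complex.real_smul]
  simp_rw [e'] at h
  rw [intervalIntegral.integral_ofReal, Complex.real_smul] at h
  norm_cast at h
  have := pi_pos
  field_simp at h
  linarith

theorem cp_reduce (f : ℝ → ℝ) 
    (hper : ∀ μ : ℝ, f (μ + 2 * π) = f μ) (x θ : ℝ) :
    ∫ μ in (0 : ℝ)..(2 * π), f μ * ((1 - θ ^ 2) / (1 - 2 * θ * Real.cos (x - μ) + θ ^ 2))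
     = 2 * π * ∫ t in Set.Ioc (-π) π,
      ((2 * π)⁻¹ * ((1 - θ ^ 2) / (1 - 2 * θ * Real.cos t + θ ^ 2))) • f (x - t) := by
  have hp : Function.Periodic (fun t => f (x - t) *
      ((1 - θ ^ 2) / (1 - 2 * θ * Real.cos t + θ ^ 2))) (2 * π) := by
    intro t
    have := hper (x - (t + 2 * π))
    simp only [Real.cos_add_two_pi]
    rw [← this]; congr 2; ring
  have h1 := intervalIntegral.integral_comp_sub_left (a := 0) (b := 2 * π) (fun t => f (x - t) *
      ((1 - θ ^ 2) / (1 - 2 * θ * Real.cos t + θ ^ 2))) x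
  have h2 := hp.intervalIntegral_add_eq (x - 2 * π) (-π)
  simp only [sub_sub_cancel] at h1
  rw [h1, sub_zero]
  rw [show x - 2 * π + 2 * π = x by ring, show -π + 2 * π = π by ring] at h2
  rw [h2, intervalIntegral.integral_of_le (by linarith [pi_pos]), ← integral_const_mul]
  congr 1
  ext t
  have := pi_pos
  simp only [smul_eq_mul]
  field_simp

lemma cp_ev : ∀ᶠ θ : ℝ in 𝓝[<] 1, 0 < θ ∧ θ < 1 := by
  filter_upwards [Ioo_mem_nhdsLT (show (0:ℝ) < 1 by norm_num)] with θ h using h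

theorem cp_poisson (f : ℝ → ℝ) (hf : Continuous f)
    (hper : ∀ μ : ℝ, f (μ + 2 * π) = f μ) (x : ℝ) :
    Tendsto (fun θ : ℝ => ∫ μ in (0 : ℝ)..(2 * π),
        f μ * ((1 - θ ^ 2) / (1 - 2 * θ * Real.cos (x - μ) + θ ^ 2)))
      (𝓝[<] 1) (𝓝 (2 * π * f x)) := by
  simp only [cp_reduce f hper x]
  refine Tendsto.const_mul _ ?_
  have hpi := pi_pos
  refine tendsto_setIntegral_peak_smul_of_integrableOn_of_tendsto (x₀ := 0)
    (t := Set.Ioc (-π) π) measurableSet_Ioc measurableSet_Ioc subset_rfl self_mem_nhdsWithin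
    (by simp) ?_ ?_ ?_ ?_ ?_ ?_
  · filter_upwards [cp_ev] with θ h t _
    have := cp_den_pos θ t h.1 h.2
    have : 0 ≤ 1 - θ ^ 2 := by nlinarith [h.1, h.2]
    positivity
  · intro u hu h0
    obtain ⟨δ, hδ, hb⟩ := Metric.isOpen_iff.1 hu 0 h0
    set d := min δ π with hd
    have hd0 : 0 < d := lt_min hδ hpi
    have hc : Real.cos d < 1 := by
      have := Real.cos_lt_cos_of_nonneg_of_le_pi le_rfl (min_le_right δ π) hd0
      simpa using this
    have hc' : 0 < 1 - Real.cos d := by linarith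
    have hlim : Tendsto (fun θ : ℝ => (2 * π)⁻¹ * ((1 - θ ^ 2) / (2 * θ * (1 - Real.cos d))))
        (𝓝[<] 1) (𝓝 0) := by
      have : ContinuousAt (fun θ : ℝ => (2 * π)⁻¹ * ((1 - θ ^ 2) / (2 * θ * (1 - Real.cos d)))) 1 := by
        refine ContinuousAt.mul (by fun_prop) (ContinuousAt.div (by fun_prop) (by fun_prop) ?_)
        simpa using hc'.ne'
      have h := this.tendsto.mono_left (nhdsWithin_le_nhds (s := Set.Iio 1))
      simpa using h
    rw [Metric.tendstoUniformlyOn_iff]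
    intro ε hε
    filter_upwards [cp_ev, hlim.eventually (gt_mem_nhds hε)] with θ h hlt t ht
    have hD := cp_den_pos θ t h.1 h.2
    have hn : 0 ≤ 1 - θ ^ 2 := by nlinarith [h.1, h.2]
    have habs : d ≤ |t| := by
      by_contra hcon
      push Not at hcon
      exact ht.2 (hb (by simpa using lt_of_lt_of_le hcon (min_le_left _ _)))
    have htp : |t| ≤ π := abs_le.2 ⟨ht.1.1.le, ht.1.2⟩
    have hcos : Real.cos t ≤ Real.cos d := by
      rw [← Real.cos_abs t]
      exact Real.cos_le_cos_of_nonneg_of_le_pi hd0.le htp habs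
    simp only [Pi.zero_apply]
    rw [dist_zero_left, Real.norm_of_nonneg (by positivity)]
    refine lt_of_le_of_lt ?_ hlt
    have hθ := h.1
    gcongr
    nlinarith [mul_le_mul_of_nonneg_left hcos hθ.le, sq_nonneg (1 - θ)]
  · refine tendsto_const_nhds.congr' ?_
    filter_upwards [cp_ev] with θ h
    rw [integral_const_mul, ← intervalIntegral.integral_of_le (by linarith)]
    have hp : Function.Periodic (fun t => 
      ((1 - θ ^ 2) / (1 - 2 * θ * Real.cos t + θ ^ 2))) (2 * π) := by
      intro t
      simp only [Real.cos_add_two_pi]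
    have h2 := hp.intervalIntegral_add_eq 0 (-π)
    rw [zero_add, cp_mass θ h.1 h.2, show -π + 2 * π = π by ring] at h2
    rw [← h2]
    field_simp
  · filter_upwards [cp_ev] with θ h
    exact (continuous_const.mul (cp_cont θ h.1 h.2)).aestronglyMeasurable
  · exact (Continuous.integrableOn_Ioc (by fun_prop))
  · have : Continuous (fun t => f (x - t)) := by fun_prop
    have h := this.tendsto 0
    simp only [sub_zero] at h
    exact h.mono_left nhdsWithin_le_nhds

/-- Cauchy's 1827 claim made precise: for `f` continuous and `2π`-periodic,
`∫_0^{2π} f(μ) K_θ(x - μ) dμ → 2π f(x)` as `θ → 1⁻`, where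
`K_θ(t) = ((1-θ)² + 2(1-θ)cos t)/(1 - 2θ cos t + θ²)`. -/
theorem cauchy_poisson_kernel_tendsto (f : ℝ → ℝ) (hf : Continuous f)
    (hper : ∀ μ : ℝ, f (μ + 2 * π) = f μ) (x : ℝ) :
    Tendsto (fun θ : ℝ => ∫ μ in (0 : ℝ)..(2 * π),
        f μ * (((1 - θ) ^ 2 + 2 * (1 - θ) * Real.cos (x - μ))
            / (1 - 2 * θ * Real.cos (x - μ) + θ ^ 2)))
      (𝓝[<] 1) (𝓝 (2 * π * f x)) := by
  have hid : Tendsto (fun θ : ℝ => θ) (𝓝[<] 1) (𝓝 1) := tendsto_id.mono_left nhdsWithin_le_nhds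
  have h1 := (hid.inv₀ one_ne_zero).mul ((cp_poisson f hf hper x).sub
    ((hid.const_sub 1).mul_const (∫ μ in (0 : ℝ)..(2 * π), f μ)))
  simp only [sub_self, zero_mul, sub_zero, inv_one, one_mul] at h1
  refine h1.congr' ?_
  filter_upwards [cp_ev] with θ h
  have hc := (cp_cont θ h.1 h.2).comp (continuous_const.sub continuous_id : Continuous fun μ => x - μ)
  rw [← intervalIntegral.integral_const_mul, ← intervalIntegral.integral_sub,
    ← intervalIntegral.integral_const_mul]
  · congr 1
    ext μ
    have := (cp_den_pos θ (x - μ) h.1 h.2).ne'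
    have h0 := h.1.ne'
    have hn : (1 - θ) ^ 2 + 2 * (1 - θ) * Real.cos (x - μ)
        = ((1 - θ ^ 2) - (1 - θ) * (1 - 2 * θ * Real.cos (x - μ) + θ ^ 2)) / θ := by
      field_simp
      ring
    rw [hn]
    generalize 1 - 2 * θ * Real.cos (x - μ) + θ ^ 2 = D at this ⊢
    field_simp
  · exact (hf.mul hc).intervalIntegrable _ _
  · exact (continuous_const.mul hf).intervalIntegrable _ _
end
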